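/- arXiv:2501.05626 — 4 statements merged into one kernel-verified Lean document; each statement's English description precedes it below -/
import Mathlib

section
/- Tally decryption correctness: for every commutative group G, every g : G, every integer sk, every finite set S (a Finset over an index type ι), and all functions t, r : ι → ℤ, decrypting the componentwise product over S of the ciphertexts Enc(g^sk, t j, r j) yields g raised to the sum of the weights: Dec(sk, ∏_{j ∈ S} Enc(g^sk, t j, r j)) = g^(∑_{j ∈ S} t j), where the product is taken in the product group G × G (i.e., iterated homomorphic addition Add). -/
/-- Exponential ElGamal encryption: `Enc g pk m r = (g^r, g^m * pk^r)`. -/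
def Enc {G : Type*} [CommGroup G] (g pk : G) (m r : ℤ) : G × G :=
  (g ^ r, g ^ m * pk ^ r)

/-- ElGamal decryption (in the exponent): `Dec sk (c1, c2) = c2 * c1^(-sk)`. -/
def Dec {G : Type*} [CommGroup G] (sk : ℤ) (ct : G × G) : G :=
  ct.2 * ct.1 ^ (-sk)

/-- Homomorphic addition of ciphertexts: componentwise multiplication. -/
def AddCt {G : Type*} [CommGroup G] (c₁ c₂ : G × G) : G × G :=
  (c₁.1 * c₂.1, c₁.2 * c₂.2)

/-- Re-randomization: `Rerand g pk (c1, c2) r' = (c1 * g^r', c2 * pk^r')`. -/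
def Rerand {G : Type*} [CommGroup G] (g pk : G) (ct : G × G) (r' : ℤ) : G × G :=
  (ct.1 * g ^ r', ct.2 * pk ^ r')

theorem Enc_zero_zero {G : Type*} [CommGroup G] (g pk : G) : Enc g pk 0 0 = 1 := by
  simp [Enc]

theorem Enc_mul_Enc {G : Type*} [CommGroup G] (g pk : G) (m₁ m₂ r₁ r₂ : ℤ) :
    Enc g pk m₁ r₁ * Enc g pk m₂ r₂ = Enc g pk (m₁ + m₂) (r₁ + r₂) := by
  simp [Enc, zpow_add, mul_mul_mul_comm]

theorem prod_Enc {G : Type*} [CommGroup G] (g pk : G) {ι : Type*} (S : Finset ι) (t r : ι → ℤ) :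
    ∏ j ∈ S, Enc g pk (t j) (r j) = Enc g pk (∑ j ∈ S, t j) (∑ j ∈ S, r j) := by
  classical
  induction S using Finset.induction_on with
  | empty => simp [Enc_zero_zero]
  | insert a S ha ih => simp [Finset.prod_insert ha, Finset.sum_insert ha, ih, Enc_mul_Enc]

theorem Dec_Enc {G : Type*} [CommGroup G] (g : G) (sk m r : ℤ) :
    Dec sk (Enc g (g ^ sk) m r) = g ^ m := by
  simp only [Dec, Enc, ← zpow_mul, ← zpow_add]
  congr 1
  ring

theorem elgamal_tally_correct {G : Type*} [CommGroup G] (g : G) (sk : ℤ)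
    {ι : Type*} (S : Finset ι) (t r : ι → ℤ) :
    Dec sk (∏ j ∈ S, Enc g (g ^ sk) (t j) (r j)) = g ^ (∑ j ∈ S, t j) := by
  rw [prod_Enc, Dec_Enc]
end

section
/- Private-voting tally correctness: fix a commutative group G, g : G, an integer sk, a finite index type ι of delegates with encrypted voting powers Enc(g^sk, w j, ρ j) for w, ρ : ι → ℤ, votes v : ι → Fin 3, and ballot randomness r : ι → Fin 3 → ℤ. Define delegate j's encrypted ballot E j : Fin 3 → G × G by E j i = Rerand(g^sk, Enc(g^sk, w j, ρ j), r j i) if i = v j, and E j i = Enc(g^sk, 0, r j i) otherwise. Then for every Finset S of ι (the delegates who vote) and every option i : Fin 3, Dec(sk, ∏_{j ∈ S} E j i) = g^(∑_{j ∈ S with v j = i} w j), where the product is taken componentwise in G × G. -/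
theorem Dec_prod {G : Type*} [CommGroup G] (sk : ℤ) {ι : Type*} (S : Finset ι) (c : ι → G × G) :
    Dec sk (∏ j ∈ S, c j) = ∏ j ∈ S, Dec sk (c j) := by
  simp only [Dec, Prod.fst_prod, Prod.snd_prod, Finset.prod_mul_distrib, Finset.prod_zpow]

theorem Rerand_Enc {G : Type*} [CommGroup G] (g pk : G) (m r r' : ℤ) :
    Rerand g pk (Enc g pk m r) r' = Enc g pk m (r + r') := by
  simp only [Rerand, Enc, zpow_add, mul_assoc]

theorem zpow_sum {G : Type*} [CommGroup G] (g : G) {ι : Type*} (S : Finset ι) (f : ι → ℤ) :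
    g ^ (∑ j ∈ S, f j) = ∏ j ∈ S, g ^ f j := by
  classical
  induction S using Finset.induction_on with
  | empty => simp
  | insert a S ha ih => rw [Finset.sum_insert ha, Finset.prod_insert ha, zpow_add, ih]

theorem private_voting_tally_correct {G : Type*} [CommGroup G] (g : G) (sk : ℤ)
    {ι : Type*} [DecidableEq ι] (w ρ : ι → ℤ) (v : ι → Fin 3) (r : ι → Fin 3 → ℤ)
    (E : ι → Fin 3 → G × G)
    (hE : ∀ j i, E j i =
      if i = v j then Rerand g (g ^ sk) (Enc g (g ^ sk) (w j) (ρ j)) (r j i)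
      else Enc g (g ^ sk) 0 (r j i)) :
    ∀ (S : Finset ι) (i : Fin 3),
      Dec sk (∏ j ∈ S, E j i) = g ^ (∑ j ∈ S.filter (fun j => v j = i), w j) := by
  intro S i
  rw [Dec_prod, zpow_sum, Finset.prod_filter]
  refine Finset.prod_congr rfl fun j _ => ?_
  rw [hE]
  by_cases h : i = v j
  · rw [if_pos h, if_pos h.symm, Rerand_Enc, Dec_Enc]
  · rw [if_neg h, if_neg (Ne.symm h), Dec_Enc, zpow_zero]
end

section
/- A well-formed private ballot contributes exactly its voting power across all options (no vote inflation): fix a commutative group G, g : G, an integer sk, a ciphertext ct : G × G (the delegate's encrypted voting power), a vote v : Fin 3, and randomness r : Fin 3 → ℤ. Define the ballot E : Fin 3 → G × G by E i = Rerand(g^sk, ct, r v) if i = v, and E i = Enc(g^sk, 0, r i) otherwise. Then ∏_{i : Fin 3} Dec(sk, E i) = Dec(sk, ct). -/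
theorem Dec_Rerand {G : Type*} [CommGroup G] (g : G) (sk : ℤ) (ct : G × G) (r : ℤ) :
    Dec sk (Rerand g (g ^ sk) ct r) = Dec sk ct := by
  have h : g ^ (sk * r) * g ^ (r * -sk) = 1 := by
    rw [← zpow_add, show sk * r + r * -sk = 0 by ring, zpow_zero]
  simp only [Dec, Rerand, mul_zpow, ← zpow_mul]
  rw [mul_mul_mul_comm, h, mul_one]

theorem private_ballot_conservation {G : Type*} [CommGroup G] (g : G) (sk : ℤ)
    (ct : G × G) (v : Fin 3) (r : Fin 3 → ℤ)
    (E : Fin 3 → G × G)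
    (hE : ∀ i, E i = if i = v then Rerand g (g ^ sk) ct (r v) else Enc g (g ^ sk) 0 (r i)) :
    ∏ i : Fin 3, Dec sk (E i) = Dec sk ct := by
  rw [Finset.prod_eq_single v]
  · rw [hE, if_pos rfl, Dec_Rerand]
  · intro i _ hi
    rw [hE, if_neg hi, Dec_Enc, zpow_zero]
  · intro hv
    exact absurd (Finset.mem_univ v) hv
end

section
/- Soundness of Merkle path verification for a pair-injective hash: let α be a type and H : α → α → α be pair-injective, meaning H a b = H a' b' implies a = a' and b = b'. Then for every k : ℕ, every leaf vector f : Fin (2^k) → α, every index i : Fin (2^k) with binary digit function b : Fin k → Bool (where b j = true iff the j-th binary digit of i, least significant first, is 1), every claimed leaf value x : α, and every vector of sibling values s : Fin k → α, if pathEval k x b s = root k f then x = f i. -/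
/-- Merkle root of a complete binary hash tree with `2^k` leaves. -/
def mroot {α : Type*} (H : α → α → α) : (k : ℕ) → (Fin (2 ^ k) → α) → α
  | 0, f => f 0
  | k + 1, f =>
    H (mroot H k (fun i => f ⟨i.val, by have := i.isLt; simp only [pow_succ]; omega⟩))
      (mroot H k (fun i => f ⟨i.val + 2 ^ k, by have := i.isLt; simp only [pow_succ]; omega⟩))

/-- Evaluation of a Merkle authentication path: `x` is the claimed leaf, `b` the binary
digits of the leaf index (least significant first, `b k` being the most significant bit
at level `k`), and `s` the vector of sibling hash values along the path. -/
def pathEval {α : Type*} (H : α → α → α) : (k : ℕ) → α → (Fin k → Bool) → (Fin k → α) → α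
  | 0, x, _, _ => x
  | k + 1, x, b, s =>
    let y := pathEval H k x (fun j => b j.castSucc) (fun j => s j.castSucc)
    if b (Fin.last k) then H (s (Fin.last k)) y else H y (s (Fin.last k))

theorem merkle_path_sound {α : Type*} (H : α → α → α)
    (hH : ∀ a b a' b', H a b = H a' b' → a = a' ∧ b = b') (k : ℕ)
    (f : Fin (2 ^ k) → α) (i : Fin (2 ^ k)) (b : Fin k → Bool)
    (hb : ∀ j : Fin k, b j = i.val.testBit j.val)
    (x : α) (s : Fin k → α)
    (h : pathEval H k x b s = mroot H k f) : x = f i := by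
  induction k with
  | zero =>
    have hi : i = 0 := Fin.ext (Nat.lt_one_iff.mp i.isLt)
    rw [hi]
    exact h
  | succ k ih =>
    have hlast := hb (Fin.last k)
    have hi : i.val < 2 ^ k * 2 := i.isLt.trans_eq (pow_succ 2 k)
    simp only [pathEval, mroot] at h
    by_cases hik : i.val < 2 ^ k
    · have hbit : b (Fin.last k) = false := by
        rw [hlast, Fin.val_last, Nat.testBit_lt_two_pow hik]
      rw [hbit] at h
      exact ih _ ⟨i.val, hik⟩ _ (fun j => hb j.castSucc) _ (hH _ _ _ _ h).1
    · obtain ⟨m, hm⟩ := Nat.exists_eq_add_of_le (not_lt.mp hik)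
      have hmk : m < 2 ^ k := by omega
      have hbit : b (Fin.last k) = true := by
        rw [hlast, Fin.val_last, hm, Nat.testBit_two_pow_add_eq, Nat.testBit_lt_two_pow hmk,
          Bool.not_false]
      rw [hbit, if_pos rfl] at h
      have hx := ih _ ⟨m, hmk⟩ _ (fun j => by
        rw [hb j.castSucc, hm, Fin.val_castSucc, Nat.testBit_two_pow_add_gt j.isLt]) _
        (hH _ _ _ _ h).2
      rw [hx]
      congr 1
      exact Fin.ext (by simp only [hm, add_comm])
end
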